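/- For every ε ∈ (0,1) there exists β₀ > 0 such that for all β ≥ β₀ the following holds: for every finite connected V ⊂ ℤ², every z ∈ V and every integer h ≥ 0, π_V(η_z > h) ≤ ε · π_V(η_z = h). -/

import Mathlib

open Filter Topology Classical

noncomputable section

abbrev Site : Type := ℤ × ℤ

/-- Nearest-neighbor adjacency in `ℤ²`. -/
def adjP (x y : Site) : Prop := |x.1 - y.1| + |x.2 - y.2| = 1

/-- The Discrete Gaussian Hamiltonian `H(η) = ∑_{x∼y} (η_x - η_y)²`, the sum running over
unordered nearest-neighbor pairs (each ordered pair is counted once, whence the factor 1/2). -/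
def dgH (η : Site → ℤ) : ℝ :=
  (1 / 2) * ∑' p : Site × Site, if adjP p.1 p.2 then ((η p.1 - η p.2 : ℤ) : ℝ) ^ 2 else 0

/-- Unnormalized weight of the event `A` for the DG model on `Λ` with zero boundary conditions. -/
def dgW (β : ℝ) (Λ : Finset Site) (A : (Site → ℤ) → Prop) : ℝ :=
  ∑' η : Site → ℤ, if (∀ x ∉ Λ, η x = 0) ∧ A η then Real.exp (-β * dgH η) else 0

/-- `π_Λ(A)`: probability of the event `A` under the DG measure on `Λ`. -/
def dgProb (β : ℝ) (Λ : Finset Site) (A : (Site → ℤ) → Prop) : ℝ :=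
  dgW β Λ A / dgW β Λ (fun _ => True)

/-- `ϖ_Λ(A)`: DG measure conditioned on the floor event `η ≥ 0`. -/
def dgProbFloor (β : ℝ) (Λ : Finset Site) (A : (Site → ℤ) → Prop) : ℝ :=
  dgW β Λ (fun η => A η ∧ ∀ x, 0 ≤ η x) / dgW β Λ (fun η => ∀ x, 0 ≤ η x)

/-- The box `Λ_L = {1,…,L}²`. -/
def box (L : ℕ) : Finset Site := Finset.Icc (1 : ℤ) (L : ℤ) ×ˢ Finset.Icc (1 : ℤ) (L : ℤ)

/-- The lattice ball `B_r = {x ∈ ℤ² : |x| ≤ r}`. -/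
def ball (r : ℝ) : Finset Site :=
  ((Finset.Icc (-⌈r⌉) ⌈r⌉) ×ˢ (Finset.Icc (-⌈r⌉) ⌈r⌉)).filter
    fun x => ((x.1 : ℝ) ^ 2 + (x.2 : ℝ) ^ 2 ≤ r ^ 2)


/-- `V` is connected under nearest-neighbor adjacency. -/
def FinConnected (V : Finset Site) : Prop :=
  ∀ x ∈ V, ∀ y ∈ V, Relation.ReflTransGen (fun a b => adjP a b ∧ b ∈ V) x y


/-! ### Geometry of the lattice -/

lemma adj_iff (u v : Site) : adjP u v ↔
    v = (u.1 + 1, u.2) ∨ v = (u.1 - 1, u.2) ∨ v = (u.1, u.2 + 1) ∨ v = (u.1, u.2 - 1) := by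
  obtain ⟨a, b⟩ := u
  obtain ⟨c, d⟩ := v
  simp only [adjP, Prod.mk.injEq]
  constructor
  · intro h
    rcases abs_cases (a - c) with ⟨h1, h2⟩ | ⟨h1, h2⟩ <;>
    rcases abs_cases (b - d) with ⟨h3, h4⟩ | ⟨h3, h4⟩ <;> omega
  · rintro (⟨rfl, rfl⟩ | ⟨rfl, rfl⟩ | ⟨rfl, rfl⟩ | ⟨rfl, rfl⟩) <;> simp

lemma adj_symm {u v : Site} (h : adjP u v) : adjP v u := by
  unfold adjP at *
  rw [abs_sub_comm v.1, abs_sub_comm v.2]; exact h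

lemma exists_closer (u z : Site) (h : u ≠ z) : ∃ v, adjP u v ∧
    (v.1 - z.1).natAbs + (v.2 - z.2).natAbs < (u.1 - z.1).natAbs + (u.2 - z.2).natAbs := by
  obtain ⟨a, b⟩ := u
  obtain ⟨c, d⟩ := z
  have h' : ¬ (a = c ∧ b = d) := by simpa [Prod.ext_iff] using h
  rcases lt_trichotomy a c with h1 | h1 | h1
  · exact ⟨(a + 1, b), (adj_iff _ _).2 (by simp), by simp only; omega⟩
  · rcases lt_trichotomy b d with h2 | h2 | h2
    · exact ⟨(a, b + 1), (adj_iff _ _).2 (by simp), by simp only; omega⟩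
    · exact absurd ⟨h1, h2⟩ h'
    · exact ⟨(a, b - 1), (adj_iff _ _).2 (by simp), by simp only; omega⟩
  · exact ⟨(a - 1, b), (adj_iff _ _).2 (by simp), by simp only; omega⟩

/-- Component of `z` along sites satisfying `P`. -/
def comp (P : Site → Prop) (z : Site) : Set Site :=
  {u | Relation.ReflTransGen (fun a b => adjP a b ∧ P b) z u}

lemma comp_self (P : Site → Prop) (z : Site) : z ∈ comp P z := Relation.ReflTransGen.refl

lemma comp_step {P : Site → Prop} {z u v : Site} (hu : u ∈ comp P z) (h : adjP u v) (hv : P v) :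
    v ∈ comp P z := Relation.ReflTransGen.tail hu ⟨h, hv⟩

lemma comp_sub {P : Site → Prop} {z : Site} (hz : P z) {u : Site} (hu : u ∈ comp P z) : P u := by
  induction hu with
  | refl => exact hz
  | tail _ h _ => exact h.2

lemma comp_const {P : Site → Prop} {z : Site} (D : Set Site) (hD : comp P z ⊆ D) (g : Site → ℤ)
    (hg : ∀ u ∈ D, ∀ v ∈ D, adjP u v → g u = g v) {u : Site} (hu : u ∈ comp P z) : g u = g z := by
  have : u ∈ comp P z ∧ g u = g z := by
    induction hu with
    | refl => exact ⟨comp_self _ _, rfl⟩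
    | tail _ h ih =>
      have h2 := comp_step ih.1 h.1 h.2
      exact ⟨h2, by rw [← ih.2]; exact (hg _ (hD ih.1) _ (hD h2) h.1).symm⟩
  exact this.2

lemma good_const {P : Site → Prop} {z : Site} (D : Set Site) (hD : comp P z ⊆ D)
    (hb : ∀ u ∈ D, ∀ v, v ∉ D → adjP u v → u ∈ comp P z) (g : Site → ℤ)
    (hg : ∀ u ∈ D, ∀ v ∈ D, adjP u v → g u = g v) : ∀ u ∈ D, g u = g z := by
  have key : ∀ n : ℕ, ∀ u ∈ D, (u.1 - z.1).natAbs + (u.2 - z.2).natAbs < n → g u = g z := by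
    intro n
    induction n with
    | zero => intro u _ h; omega
    | succ n ih =>
      intro u hu h
      by_cases hC : u ∈ comp P z
      · exact comp_const D hD g hg hC
      · have hne : u ≠ z := by rintro rfl; exact hC (comp_self _ _)
        obtain ⟨v, hv, hlt⟩ := exists_closer u z hne
        have hvD : v ∈ D := by
          by_contra hvD
          exact hC (hb u hu v hvD hv)
        rw [hg u hu v hvD hv]
        exact ih v hvD (by omega)
  intro u hu
  exact key _ u hu (Nat.lt_succ_self _)

/-- A constant along lattice edges function outside a box, vanishing on the right, vanishes. -/
lemma outside_box (R R1 : ℤ) (g : Site → ℤ) (h0 : ∀ u : Site, R1 ≤ u.1 → g u = 0)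
    (hg : ∀ u v : Site, (R ≤ |u.1| ∨ R ≤ |u.2|) → (R ≤ |v.1| ∨ R ≤ |v.2|) → adjP u v → g u = g v) :
    ∀ u : Site, (R ≤ |u.1| ∨ R ≤ |u.2|) → g u = 0 := by
  have h1 : ∀ n : ℕ, ∀ x y : ℤ, R ≤ |y| → R1 - x ≤ n → g (x, y) = 0 := by
    intro n
    induction n with
    | zero => intro x y _ hx; exact h0 _ (by simp at hx; exact hx)
    | succ n ih =>
      intro x y hy hx
      rw [hg (x, y) (x + 1, y) (Or.inr hy) (Or.inr hy) ((adj_iff _ _).2 (by simp))]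
      exact ih _ _ hy (by push_cast at hx; omega)
  have h1' : ∀ x y : ℤ, R ≤ |y| → g (x, y) = 0 := fun x y hy =>
    h1 (R1 - x).toNat x y hy (Int.self_le_toNat _)
  have h2 : ∀ n : ℕ, ∀ x y : ℤ, R ≤ |x| → R - y ≤ n → g (x, y) = 0 := by
    intro n
    induction n with
    | zero => intro x y _ hy; exact h1' _ _ (le_trans (by simpa using hy) (le_abs_self y))
    | succ n ih =>
      intro x y hx hy
      rw [hg (x, y) (x, y + 1) (Or.inl hx) (Or.inl hx) ((adj_iff _ _).2 (by simp))]
      exact ih _ _ hx (by push_cast at hy; omega)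
  rintro ⟨x, y⟩ (h | h)
  · exact h2 (R - y).toNat x y h (Int.self_le_toNat _)
  · exact h1' x y h

lemma exists_box (A : Finset Site) : ∃ R : ℤ, ∀ u ∈ A, |u.1| < R ∧ |u.2| < R := by
  induction A using Finset.induction_on with
  | empty => exact ⟨0, by simp⟩
  | insert a s _ ih =>
    obtain ⟨R, hR⟩ := ih
    refine ⟨max R (max (|a.1| + 1) (|a.2| + 1)), ?_⟩
    intro u hu
    rcases Finset.mem_insert.1 hu with rfl | hu
    · constructor <;> simp
    · exact ⟨lt_max_of_lt_left (hR u hu).1, lt_max_of_lt_left (hR u hu).2⟩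

/-- Oriented edge boundary. -/
def bd (A : Finset Site) : Finset (Site × Site) :=
  (A.biUnion fun a => ({(a, (a.1 + 1, a.2)), (a, (a.1 - 1, a.2)), (a, (a.1, a.2 + 1)),
    (a, (a.1, a.2 - 1))} : Finset (Site × Site))).filter fun p => p.2 ∉ A

lemma mem_bd (A : Finset Site) (u v : Site) : (u, v) ∈ bd A ↔ u ∈ A ∧ v ∉ A ∧ adjP u v := by
  simp only [bd, Finset.mem_filter, Finset.mem_biUnion, Finset.mem_insert, Finset.mem_singleton,
    adj_iff]
  constructor
  · rintro ⟨⟨a, ha, h⟩, h2⟩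
    simp only [Prod.mk.injEq] at h
    have hua : u = a := by tauto
    subst hua
    refine ⟨ha, h2, ?_⟩
    tauto
  · rintro ⟨h1, h2, h3⟩
    refine ⟨⟨u, h1, ?_⟩, h2⟩
    simp only [Prod.mk.injEq, true_and]
    exact h3

/-- Contour interiors. -/
def IsCont (A : Finset Site) : Prop :=
  (∀ g : Site → ℤ, (∀ u ∈ A, ∀ v ∈ A, adjP u v → g u = g v) → ∀ u ∈ A, ∀ v ∈ A, g u = g v) ∧
  (∀ g : Site → ℤ, (∃ R : ℤ, ∀ u : Site, R ≤ u.1 → g u = 0) →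
    (∀ u, u ∉ A → ∀ v, v ∉ A → adjP u v → g u = g v) → ∀ u, u ∉ A → g u = 0)

/-- two finite sets with the same boundary coincide -/
lemma bd_inj {A B : Finset Site} (h : bd A = bd B) : A = B := by
  obtain ⟨R, hR⟩ := exists_box (A ∪ B)
  let g : Site → ℤ := fun u => (if u ∈ A then 1 else 0) - (if u ∈ B then 1 else 0)
  have hg : ∀ u v : Site, adjP u v → g u = g v := by
    intro u v huv
    have h1 := mem_bd A u v
    have h2 := mem_bd B u v
    have h3 := mem_bd A v u
    have h4 := mem_bd B v u
    have huv' := adj_symm huv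
    rw [h] at h1 h3
    simp only [g]
    by_cases a1 : u ∈ A <;> by_cases a2 : v ∈ A <;> by_cases a3 : u ∈ B <;> by_cases a4 : v ∈ B <;>
      simp_all
  have hz : ∀ u, g u = 0 := by
    obtain ⟨w, hw⟩ : ∃ w : Site, w = (max R 0, 0) := ⟨_, rfl⟩
    have hw0 : g w = 0 := by
      have : w ∉ A ∪ B := fun hm => by
        have := (hR w hm).1
        rw [hw] at this
        have h2 := le_abs_self (max R 0)
        have h3 := le_max_left R 0
        simp only at this
        omega
      simp only [Finset.mem_union, not_or] at this
      simp [g, this]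
    intro u
    rw [← hw0]
    exact good_const (P := fun _ => True) (z := w) Set.univ (fun _ _ => trivial)
      (fun u _ v hv => absurd trivial hv) g (fun u _ v _ => hg u v) u trivial
  ext u
  have := hz u
  simp only [g] at this
  by_cases a1 : u ∈ A <;> by_cases a2 : u ∈ B <;> simp_all

/-! ### Connectivity of contours -/

/-- moves -/
def Mv : Finset (Site × Site) :=
  (Finset.Icc (-1 : ℤ) 1 ×ˢ Finset.Icc (-1 : ℤ) 1) ×ˢ (Finset.Icc (-1 : ℤ) 1 ×ˢ Finset.Icc (-1 : ℤ) 1)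

lemma card_Mv : Mv.card = 81 := by
  simp [Mv, Finset.card_product]

lemma mem_Mv (p : Site × Site) : p ∈ Mv ↔ (-1 ≤ p.1.1 ∧ p.1.1 ≤ 1) ∧ (-1 ≤ p.1.2 ∧ p.1.2 ≤ 1) ∧
    (-1 ≤ p.2.1 ∧ p.2.1 ≤ 1) ∧ (-1 ≤ p.2.2 ∧ p.2.2 ≤ 1) := by
  simp only [Mv, Finset.mem_product, Finset.mem_Icc]
  tauto

/-- A closed form on the lattice vanishing on the right is exact. -/
lemma exact_form (w : Site → Site → ℤ) (R : ℤ)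
    (hR : ∀ u v : Site, R ≤ u.1 → R ≤ v.1 → w u v = 0)
    (hanti : ∀ u v, w v u = - w u v)
    (hcl : ∀ x y : ℤ, w (x, y) (x + 1, y) + w (x + 1, y) (x + 1, y + 1)
      = w (x, y) (x, y + 1) + w (x, y + 1) (x + 1, y + 1)) :
    ∃ g : Site → ℤ, (∀ u : Site, R ≤ u.1 → g u = 0) ∧ ∀ u v, adjP u v → g u - g v = w u v := by
  let G : ℕ → ℤ → ℤ := fun n y => ∑ k ∈ Finset.range n, w (R - 1 - k, y) (R - 1 - k + 1, y)
  let g : Site → ℤ := fun u => G (R - u.1).toNat u.2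
  have g0 : ∀ u : Site, R ≤ u.1 → g u = 0 := by
    intro u hu
    have : (R - u.1).toNat = 0 := by omega
    simp [g, G, this]
  have hh : ∀ x y : ℤ, g (x, y) = g (x + 1, y) + w (x, y) (x + 1, y) := by
    intro x y
    by_cases hx : R ≤ x
    · rw [g0 _ hx, g0 _ (by simp only; omega), hR _ _ hx (by simp only; omega)]; simp
    · obtain ⟨n, hn⟩ : ∃ n : ℕ, (R - x).toNat = n + 1 := ⟨(R - x).toNat - 1, by omega⟩
      have hn' : (R - (x + 1)).toNat = n := by omega
      have hx' : R - 1 - (n : ℤ) = x := by omega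
      simp only [g, G, hn, hn', Finset.sum_range_succ, hx']
  have hv : ∀ n : ℕ, ∀ x y : ℤ, R - x ≤ n → g (x, y) = g (x, y + 1) + w (x, y) (x, y + 1) := by
    intro n
    induction n with
    | zero =>
      intro x y hx
      have hx : R ≤ x := by simpa using hx
      rw [g0 _ hx, g0 _ hx, hR _ _ hx hx]; simp
    | succ n ih =>
      intro x y hx
      have h1 := ih (x + 1) y (by push_cast at hx; omega)
      have h2 := hh x y
      have h3 := hh x (y + 1)
      have h4 := hcl x y
      linarith
  have hv' : ∀ x y : ℤ, g (x, y) = g (x, y + 1) + w (x, y) (x, y + 1) := fun x y =>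
    hv (R - x).toNat x y (Int.self_le_toNat _)
  refine ⟨g, g0, ?_⟩
  intro u v h
  obtain ⟨x, y⟩ := u
  rcases (adj_iff _ _).1 h with rfl | rfl | rfl | rfl
  · have := hh x y
    simp only; linarith
  · have := hh (x - 1) y
    have h2 := hanti (x - 1, y) (x, y)
    simp only [sub_add_cancel] at *; linarith
  · have := hv' x y
    simp only; linarith
  · have := hv' x (y - 1)
    have h2 := hanti (x, y - 1) (x, y)
    simp only [sub_add_cancel] at *; linarith

lemma timar {A : Finset Site} (hA : IsCont A) (T : Finset (Site × Site)) (hT : T ⊆ bd A)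
    (p0 : Site × Site) (hp0 : p0 ∈ T)
    (hcl : ∀ p ∈ T, ∀ q ∈ bd A, q - p ∈ Mv → q ∈ T) : T = bd A := by
  obtain ⟨R, hR⟩ := exists_box A
  let χ : Site → ℤ := fun u => if u ∈ A then 1 else 0
  let E : Site → Site → Prop := fun u v => (u, v) ∈ T ∨ (v, u) ∈ T
  let w : Site → Site → ℤ := fun u v => if E u v then χ u - χ v else 0
  have hE : ∀ u v, E u v → E v u := fun u v h => Or.symm h
  have hχ : ∀ u : Site, R ≤ u.1 → χ u = 0 := by
    intro u hu
    have : u ∉ A := fun h => by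
      have := (hR u h).1
      have := le_abs_self u.1
      omega
    simp [χ, this]
  have hnE : ∀ u v, adjP u v → ¬ ((u, v) ∈ bd A ∨ (v, u) ∈ bd A) → χ u = χ v := by
    intro u v h hn
    simp only [mem_bd, h, adj_symm h, and_true] at hn
    simp only [χ]
    by_cases a : u ∈ A <;> by_cases b : v ∈ A <;> simp_all
  have hclosed : ∀ x y : ℤ, w (x, y) (x + 1, y) + w (x + 1, y) (x + 1, y + 1)
      = w (x, y) (x, y + 1) + w (x, y + 1) (x + 1, y + 1) := by
    intro x y
    have ad1 : adjP (x, y) (x + 1, y) := (adj_iff _ _).2 (by simp)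
    have ad2 : adjP (x + 1, y) (x + 1, y + 1) := (adj_iff _ _).2 (by simp)
    have ad3 : adjP (x, y) (x, y + 1) := (adj_iff _ _).2 (by simp)
    have ad4 : adjP (x, y + 1) (x + 1, y + 1) := (adj_iff _ _).2 (by simp)
    let Q : Site → Prop := fun u => (u.1 = x ∨ u.1 = x + 1) ∧ (u.2 = y ∨ u.2 = y + 1)
    by_cases hex : ∃ p ∈ T, Q p.1 ∧ Q p.2
    · obtain ⟨p, hp, hp1, hp2⟩ := hex
      have hall : ∀ q ∈ bd A, Q q.1 → Q q.2 → q ∈ T := by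
        intro q hq hq1 hq2
        apply hcl p hp q hq
        rw [mem_Mv]
        simp only [Q] at hp1 hp2 hq1 hq2
        simp only [Prod.fst_sub, Prod.snd_sub]
        omega
      have hw : ∀ u v, Q u → Q v → adjP u v → w u v = χ u - χ v := by
        intro u v hu hv huv
        by_cases h : E u v
        · simp [w, h]
        · have := hnE u v huv (fun h' => h (h'.imp (fun h' => hall _ h' hu hv)
            (fun h' => hall _ h' hv hu)))
          simp [w, h, this]
      rw [hw _ _ (by simp [Q]) (by simp [Q]) ad1, hw _ _ (by simp [Q]) (by simp [Q]) ad2,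
        hw _ _ (by simp [Q]) (by simp [Q]) ad3, hw _ _ (by simp [Q]) (by simp [Q]) ad4]
      ring
    · have hw : ∀ u v, Q u → Q v → w u v = 0 := by
        intro u v hu hv
        have : ¬ E u v := by
          rintro (h | h)
          · exact hex ⟨_, h, hu, hv⟩
          · exact hex ⟨_, h, hv, hu⟩
        simp [w, this]
      rw [hw _ _ (by simp [Q]) (by simp [Q]), hw _ _ (by simp [Q]) (by simp [Q]),
        hw _ _ (by simp [Q]) (by simp [Q]), hw _ _ (by simp [Q]) (by simp [Q])]
  obtain ⟨g, hg0, hg⟩ := exact_form w R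
    (by
      intro u v hu hv
      simp only [w, hχ u hu, hχ v hv]; simp)
    (by
      intro u v
      by_cases h : E u v
      · simp [w, h, hE _ _ h]
      · have : ¬ E v u := fun h' => h (hE _ _ h')
        simp [w, h, this])
    hclosed
  have heq : ∀ u v, χ u = χ v → adjP u v → g u = g v := by
    intro u v h huv
    have := hg u v huv
    simp only [w, h, sub_self, ite_self] at this
    linarith
  have hin := hA.1 g (fun u hu v hv huv => heq u v (by simp [χ, hu, hv]) huv)
  have hout := hA.2 g ⟨R, hg0⟩ (fun u hu v hv huv => heq u v (by simp [χ, hu, hv]) huv)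
  apply Finset.Subset.antisymm hT
  rintro ⟨u, v⟩ hq
  by_contra hqT
  obtain ⟨a, b⟩ := p0
  have h1 := (mem_bd _ _ _).1 (hT hp0)
  have h2 := (mem_bd _ _ _).1 hq
  have e1 := hg a b h1.2.2
  have e2 := hg u v h2.2.2
  have hEab : E a b := Or.inl hp0
  have hEuv : ¬ E u v := by
    rintro (h | h)
    · exact hqT h
    · exact h2.2.1 ((mem_bd _ _ _).1 (hT h)).1
  simp only [w, hEab, hEuv, if_true, if_false, χ, h1.1, h1.2.1] at e1 e2
  rw [hout b h1.2.1] at e1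
  rw [hout v h2.2.1, hin u h2.1 a h1.1] at e2
  omega

/-! ### Encoding by walks -/

/-- sites visited by the walk -/
def visited : Site × Site → List Mv → Finset (Site × Site)
  | p, [] => {p}
  | p, m :: c => insert p (visited (p + m.1) c)

lemma self_mem_visited (p : Site × Site) (c : List Mv) : p ∈ visited p c := by
  cases c <;> simp [visited]

lemma neg_mem_Mv {m : Site × Site} (h : m ∈ Mv) : -m ∈ Mv := by
  rw [mem_Mv] at *
  simp only [Prod.fst_neg, Prod.snd_neg]
  omega

lemma visited_insert (c : List Mv) : ∀ (p t : Site × Site) (m : Mv), t ∈ visited p c →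
    ∃ c' : List Mv, c'.length = c.length + 2 ∧ visited p c' = insert (t + m.1) (visited p c) := by
  have base : ∀ (c : List Mv) (p : Site × Site) (m : Mv),
    ∃ c' : List Mv, c'.length = c.length + 2 ∧ visited p c' = insert (p + m.1) (visited p c) := by
    intro c p m
    refine ⟨m :: ⟨-m.1, neg_mem_Mv m.2⟩ :: c, by simp, ?_⟩
    simp only [visited, add_neg_cancel_right]
    rw [Finset.insert_comm, Finset.insert_eq_self.2 (self_mem_visited p c)]
  induction c with
  | nil =>
    intro p t m ht
    simp only [visited, Finset.mem_singleton] at ht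
    subst ht
    exact base [] t m
  | cons a c ih =>
    intro p t m ht
    rcases Finset.mem_insert.1 (show t ∈ insert p (visited (p + a.1) c) from ht) with rfl | h
    · exact base _ t m
    · obtain ⟨c', h1, h2⟩ := ih _ t m h
      refine ⟨a :: c', by simp [h1], ?_⟩
      simp only [visited, h2]
      rw [Finset.insert_comm]

lemma exists_code {A : Finset Site} (hA : IsCont A) (p0 : Site × Site) (hp0 : p0 ∈ bd A) :
    ∃ c : List Mv, c.length + 2 = 2 * (bd A).card ∧ visited p0 c = bd A := by
  have key : ∀ n : ℕ, n + 1 ≤ (bd A).card → ∃ c : List Mv, c.length = 2 * n ∧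
      visited p0 c ⊆ bd A ∧ (visited p0 c).card = n + 1 := by
    intro n
    induction n with
    | zero => intro _; exact ⟨[], by simp [visited, hp0]⟩
    | succ n ih =>
      intro hn
      obtain ⟨c, h1, h2, h3⟩ := ih (by omega)
      have : ∃ p ∈ visited p0 c, ∃ q ∈ bd A, q - p ∈ Mv ∧ q ∉ visited p0 c := by
        by_contra hcon
        push Not at hcon
        have := timar hA (visited p0 c) h2 p0 (self_mem_visited _ _) hcon
        rw [this] at h3
        omega
      obtain ⟨p, hp, q, hq, hm, hq'⟩ := this
      obtain ⟨c', h4, h5⟩ := visited_insert c p0 p ⟨q - p, hm⟩ hp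
      simp only [add_sub_cancel] at h5
      refine ⟨c', by omega, ?_, ?_⟩
      · rw [h5]; exact Finset.insert_subset hq h2
      · rw [h5, Finset.card_insert_of_notMem hq', h3]
  have hpos : 0 < (bd A).card := Finset.card_pos.2 ⟨_, hp0⟩
  obtain ⟨c, h1, h2, h3⟩ := key ((bd A).card - 1) (by omega)
  exact ⟨c, by omega, Finset.eq_of_subset_of_card_le h2 (by omega)⟩

lemma exit_up (A : Finset Site) (d : Site) (hd : d ≠ 0) (u : Site) (hu : u ∈ A) :
    ∃ k : ℕ, (∀ i ≤ k, u + (i : ℤ) • d ∈ A) ∧ u + ((k + 1 : ℕ) : ℤ) • d ∉ A := by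
  have hex : ∃ k : ℕ, u + (k : ℤ) • d ∉ A := by
    by_contra hcon
    push Not at hcon
    have hinj : Function.Injective (fun k : ℕ => u + (k : ℤ) • d) := by
      intro a b hab
      simp only [add_right_inj] at hab
      have := smul_left_injective ℤ hd hab
      exact_mod_cast this
    exact (Set.infinite_of_injective_forall_mem hinj hcon) (Finset.finite_toSet A)
  have h0 : Nat.find hex ≠ 0 := by
    intro h
    have := Nat.find_spec hex
    rw [h] at this
    simp [hu] at this
  obtain ⟨k, hk⟩ := Nat.exists_eq_succ_of_ne_zero h0
  refine ⟨k, ?_, ?_⟩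
  · intro i hi
    have := Nat.find_min hex (m := i) (by omega)
    simpa using this
  · have := Nat.find_spec hex
    rw [hk] at this
    exact this

lemma exists_start (A : Finset Site) (x : Site) (hx : x ∈ A) :
    ∃ j : ℕ, j < (bd A).card ∧ ((x.1 + j, x.2), (x.1 + j + 1, x.2)) ∈ bd A := by
  obtain ⟨k, hk1, hk2⟩ := exit_up A (1, 0) (by simp) x hx
  have hsm : ∀ i : ℕ, x + (i : ℤ) • ((1, 0) : Site) = (x.1 + i, x.2) := by
    intro i; ext <;> simp
  refine ⟨k, ?_, ?_⟩
  · have hsub : (Finset.range (k + 1)).image (fun i : ℕ => x.1 + (i : ℤ)) ⊆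
        (bd A).image (fun p => p.1.1) := by
      intro y hy
      obtain ⟨i, hi, rfl⟩ := Finset.mem_image.1 hy
      have hi' := hk1 i (by simpa [Nat.lt_succ_iff] using hi)
      rw [hsm] at hi'
      obtain ⟨l, hl1, hl2⟩ := exit_up A (0, 1) (by simp) _ hi'
      refine Finset.mem_image.2 ⟨((x.1 + i, x.2) + (l : ℤ) • ((0, 1) : Site),
        (x.1 + i, x.2) + ((l + 1 : ℕ) : ℤ) • ((0, 1) : Site)), ?_, by simp⟩
      rw [mem_bd]
      refine ⟨hl1 l le_rfl, hl2, (adj_iff _ _).2 ?_⟩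
      right; right; left
      ext <;> simp [add_assoc]
    have h1 := (Finset.card_le_card hsub).trans Finset.card_image_le
    rw [Finset.card_image_of_injective _ (fun a b h => by simpa using h), Finset.card_range] at h1
    omega
  · rw [mem_bd]
    have h1 := hk1 k le_rfl
    rw [hsm] at h1 hk2
    refine ⟨h1, ?_, (adj_iff _ _).2 (by simp)⟩
    push_cast at hk2
    rwa [← add_assoc] at hk2

/-! ### Summing over contours -/

open scoped ENNReal

lemma list_sum (r : ℝ≥0∞) : ∑' c : List Mv, r ^ c.length = (1 - 81 * r)⁻¹ := by
  rw [← (Equiv.sigmaFiberEquiv (List.length : List Mv → ℕ)).tsum_eq, ENNReal.tsum_sigma',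
    ← ENNReal.tsum_geometric]
  congr 1
  ext n
  have h : ∀ c : {c : List Mv // c.length = n},
      r ^ ((Equiv.sigmaFiberEquiv (List.length : List Mv → ℕ)) ⟨n, c⟩).length = r ^ n := by
    intro c
    simp [Equiv.sigmaFiberEquiv, c.2]
  simp only [h]
  have hc : Fintype.card (List.Vector Mv n) = 81 ^ n := by
    rw [card_vector]; simp [card_Mv]
  change ∑' c : List.Vector Mv n, r ^ n = _
  rw [tsum_fintype, Finset.sum_const, Finset.card_univ, hc, mul_pow]
  simp

lemma contour_sum (x : Site) (r : ℝ≥0∞) (hr : 81 * r ≤ 2⁻¹) :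
    ∑' A : {A : Finset Site // x ∈ A ∧ IsCont A}, (r ^ 3) ^ (bd A.1).card ≤ 4 * r := by
  have hcode : ∀ A : {A : Finset Site // x ∈ A ∧ IsCont A}, ∃ jc : ℕ × List Mv,
      jc.1 < (bd A.1).card ∧ jc.2.length + 2 = 2 * (bd A.1).card ∧
      visited ((x.1 + jc.1, x.2), (x.1 + jc.1 + 1, x.2)) jc.2 = bd A.1 := by
    rintro ⟨A, hx, hA⟩
    obtain ⟨j, hj, hp⟩ := exists_start A x hx
    obtain ⟨c, h1, h2⟩ := exists_code hA _ hp
    exact ⟨(j, c), hj, h1, h2⟩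
  choose Φ h1 h2 h3 using hcode
  have hinj : Function.Injective Φ := by
    intro A B h
    apply Subtype.ext
    apply bd_inj
    rw [← h3 A, ← h3 B, h]
  have hr1 : r ≤ 2⁻¹ := le_trans (by
    calc r = 1 * r := by simp
      _ ≤ 81 * r := by gcongr; norm_num) hr
  have hr1' : r ≤ 1 := hr1.trans (by norm_num)
  have hsub : ∀ s : ℝ≥0∞, s ≤ 2⁻¹ → (1 - s)⁻¹ ≤ 2 := by
    intro s hs
    have : (2 : ℝ≥0∞)⁻¹ ≤ 1 - s := by
      calc (2 : ℝ≥0∞)⁻¹ = 1 - 2⁻¹ := by rw [ENNReal.one_sub_inv_two]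
        _ ≤ 1 - s := tsub_le_tsub_left hs 1
    exact ENNReal.inv_le_iff_inv_le.1 this
  calc ∑' A : {A : Finset Site // x ∈ A ∧ IsCont A}, (r ^ 3) ^ (bd A.1).card
      ≤ ∑' A : {A : Finset Site // x ∈ A ∧ IsCont A}, r * (r ^ (Φ A).1 * r ^ (Φ A).2.length) := by
        apply ENNReal.tsum_le_tsum
        intro A
        rw [← pow_mul, ← pow_add, ← pow_succ']
        apply pow_le_pow_right_of_le_one' hr1'
        have := h1 A
        have := h2 A
        omega
    _ ≤ ∑' jc : ℕ × List Mv, r * (r ^ jc.1 * r ^ jc.2.length) :=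
        ENNReal.tsum_comp_le_tsum_of_injective hinj
          (fun jc : ℕ × List Mv => r * (r ^ jc.1 * r ^ jc.2.length))
    _ = r * ((1 - r)⁻¹ * (1 - 81 * r)⁻¹) := by
        rw [ENNReal.tsum_mul_left, ENNReal.tsum_prod (f := fun (a : ℕ) (c : List Mv) => r ^ a * r ^ c.length)]
        simp only [ENNReal.tsum_mul_left, ENNReal.tsum_mul_right, list_sum, ENNReal.tsum_geometric]
    _ ≤ r * (2 * 2) := by
        gcongr
        · exact hsub _ hr1
        · exact hsub _ hr
    _ = 4 * r := by rw [mul_comm]; norm_num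

/-! ### Existence of contours -/

/-- `D` is a filling of the component `C`. -/
def Good (C : Set Site) (D : Finset Site) : Prop :=
  C ⊆ ↑D ∧ ∀ u ∈ D, ∀ v, v ∉ D → adjP u v → u ∈ C

lemma exists_hole {P : Site → Prop} {z : Site} {D : Finset Site} (hD : Good (comp P z) D)
    {x : Site} (hxD : x ∈ D) (hx : x ∉ comp P z) :
    ∃ K : Finset Site, (x ∈ K ∧ IsCont K) ∧ Good (comp P z) (D \ K) ∧
      (bd D).card + (bd K).card ≤ (bd (D \ K)).card := by
  let U : Set Site := comp (fun u => u ∉ comp P z) x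
  have hUC : ∀ u ∈ U, u ∉ comp P z := fun u hu => comp_sub (P := fun u => u ∉ comp P z) hx hu
  have hUD : ∀ u ∈ U, u ∈ D := by
    intro u hu
    have : u ∈ U ∧ u ∈ D := by
      induction hu with
      | refl => exact ⟨comp_self _ _, hxD⟩
      | tail _ h ih =>
        refine ⟨comp_step ih.1 h.1 h.2, ?_⟩
        by_contra hb
        exact hUC _ ih.1 (hD.2 _ ih.2 _ hb h.1)
    exact this.2
  obtain ⟨K, hK⟩ : ∃ K : Finset Site, ∀ u, u ∈ K ↔ u ∈ U :=
    ⟨D.filter (· ∈ U), fun u => by simp only [Finset.mem_filter]; exact ⟨fun h => h.2, fun h => ⟨hUD u h, h⟩⟩⟩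
  have hbK : ∀ u v, u ∉ K → v ∈ K → adjP u v → u ∈ comp P z := by
    intro u v hu hv huv
    by_contra h
    exact hu ((hK u).2 (comp_step ((hK v).1 hv) (adj_symm huv) h))
  have hCK : ∀ u ∈ comp P z, u ∉ K := fun u hu h => hUC u ((hK u).1 h) hu
  refine ⟨K, ⟨(hK x).2 (comp_self _ _), ?_, ?_⟩, ⟨?_, ?_⟩, ?_⟩
  · intro g hg u hu v hv
    have h := fun u hu => comp_const (P := fun u => u ∉ comp P z) (z := x) (↑K : Set Site)
      (fun u hu => (hK u).2 hu) g hg (u := u) hu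
    rw [h u ((hK u).1 hu), h v ((hK v).1 hv)]
  · rintro g ⟨R, hR⟩ hg
    have h := good_const (P := P) (z := z) ({u | u ∉ K} : Set Site) hCK
      (fun u hu v hv huv => hbK u v hu (by simpa using hv) huv) g hg
    obtain ⟨R', hR'⟩ := exists_box K
    have hw : ((max R R', 0) : Site) ∉ K := by
      intro hm
      have h1 := (hR' _ hm).1
      have h2 := le_abs_self (max R R')
      have h3 := le_max_right R R'
      simp only at h1
      omega
    intro u hu
    rw [h u hu, ← h _ hw]
    exact hR _ (le_max_left _ _)
  · intro u hu
    simp only [Finset.coe_sdiff, Set.mem_sdiff, Finset.mem_coe]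
    exact ⟨hD.1 hu, hCK u hu⟩
  · intro u hu v hv huv
    simp only [Finset.mem_sdiff, not_and, not_not] at hu hv
    by_cases hvD : v ∈ D
    · exact hbK u v hu.2 (hv hvD) huv
    · exact hD.2 u hu.1 v hvD huv
  · have hdisj : Disjoint (bd D) ((bd K).image Prod.swap) := by
      rw [Finset.disjoint_left]
      rintro ⟨u, v⟩ h1 h2
      obtain ⟨⟨a, b⟩, h3, h4⟩ := Finset.mem_image.1 h2
      simp only [Prod.swap_prod_mk, Prod.mk.injEq] at h4
      obtain ⟨rfl, rfl⟩ := h4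
      exact ((mem_bd _ _ _).1 h1).2.1 (hUD _ ((hK _).1 ((mem_bd _ _ _).1 h3).1))
    have hsub : bd D ∪ (bd K).image Prod.swap ⊆ bd (D \ K) := by
      rintro ⟨u, v⟩ h
      rw [mem_bd]
      simp only [Finset.mem_sdiff, not_and, not_not]
      rcases Finset.mem_union.1 h with h | h
      · have := (mem_bd _ _ _).1 h
        exact ⟨⟨this.1, hCK _ (hD.2 u this.1 v this.2.1 this.2.2)⟩, fun h' => absurd h' this.2.1,
          this.2.2⟩
      · obtain ⟨⟨a, b⟩, h3, h4⟩ := Finset.mem_image.1 h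
        simp only [Prod.swap_prod_mk, Prod.mk.injEq] at h4
        obtain ⟨rfl, rfl⟩ := h4
        have := (mem_bd _ _ _).1 h3
        have h5 := adj_symm this.2.2
        exact ⟨⟨hD.1 (hbK _ _ this.2.1 this.1 h5), this.2.1⟩, fun _ => this.1, h5⟩
    have := Finset.card_le_card hsub
    rw [Finset.card_union_of_disjoint hdisj,
      Finset.card_image_of_injective _ Prod.swap_injective] at this
    exact this

lemma exists_outer {P : Site → Prop} {z : Site} {V : Finset Site} (hV : comp P z ⊆ ↑V) :
    ∃ D : Finset Site, (z ∈ D ∧ IsCont D) ∧ Good (comp P z) D := by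
  obtain ⟨R, hR⟩ := exists_box V
  let O : Site → Prop := fun u => R ≤ |u.1| ∨ R ≤ |u.2|
  have hOC : ∀ u, O u → u ∉ comp P z := by
    intro u hu hc
    have := hR u (hV hc)
    rcases hu with h | h <;> omega
  let U : Set Site := {u | ∃ v, O v ∧ u ∈ comp (fun u => u ∉ comp P z) v}
  have hOU : ∀ u, O u → u ∈ U := fun u hu => ⟨u, hu, comp_self _ _⟩
  have hUC : ∀ u ∈ U, u ∉ comp P z := by
    rintro u ⟨v, hv, hu⟩
    exact comp_sub (P := fun u => u ∉ comp P z) (hOC v hv) hu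
  have hUstep : ∀ u ∈ U, ∀ v, adjP u v → v ∉ comp P z → v ∈ U := by
    rintro u ⟨w, hw, hu⟩ v huv hv
    exact ⟨w, hw, comp_step hu huv hv⟩
  obtain ⟨D, hD⟩ : ∃ D : Finset Site, ∀ u, u ∈ D ↔ u ∉ U := by
    refine ⟨(Finset.Icc (-R) R ×ˢ Finset.Icc (-R) R).filter (· ∉ U), fun u => ?_⟩
    simp only [Finset.mem_filter, Finset.mem_product, Finset.mem_Icc]
    refine ⟨fun h => h.2, fun h => ⟨?_, h⟩⟩
    have : ¬ O u := fun h' => h (hOU u h')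
    simp only [O, not_or, not_le, abs_lt] at this
    omega
  have hG : Good (comp P z) D := by
    refine ⟨fun u hu => (hD u).2 (fun h => hUC u h hu), ?_⟩
    intro u hu v hv huv
    by_contra hc
    have hv' : v ∈ U := by
      by_contra h; exact hv ((hD v).2 h)
    exact (hD u).1 hu (hUstep v hv' u (adj_symm huv) hc)
  refine ⟨D, ⟨hG.1 (comp_self _ _), ?_, ?_⟩, hG⟩
  · intro g hg u hu v hv
    have h := good_const (P := P) (z := z) (↑D : Set Site) hG.1 hG.2 g hg
    rw [h u hu, h v hv]
  · rintro g ⟨R1, hR1⟩ hg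
    have hUD : ∀ u, u ∈ U → u ∉ D := fun u hu h => (hD u).1 h hu
    have hout := outside_box R R1 g hR1 (fun u v hu hv huv =>
      hg u (hUD u (hOU u hu)) v (hUD v (hOU v hv)) huv)
    intro u hu
    have hu' : u ∈ U := by
      by_contra h; exact hu ((hD u).2 h)
    obtain ⟨v, hv, huv⟩ := hu'
    rw [comp_const (P := fun u => u ∉ comp P z) (z := v) U (fun w hw => ⟨v, hv, hw⟩) g
      (fun a ha b hb => hg a (hUD a ha) b (hUD b hb)) huv]
    exact hout v hv

/-! ### Energy estimate -/

lemma dgH_eq (W : Finset Site) : ∃ N : Finset Site, (∀ D ⊆ W, bd D ⊆ N ×ˢ N) ∧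
    ∀ η : Site → ℤ, (∀ x, x ∉ W → η x = 0) →
    dgH η = (1 / 2) * ∑ p ∈ N ×ˢ N,
      if adjP p.1 p.2 then ((η p.1 - η p.2 : ℤ) : ℝ) ^ 2 else 0 := by
  refine ⟨W.biUnion fun a => ({a, (a.1 + 1, a.2), (a.1 - 1, a.2), (a.1, a.2 + 1),
    (a.1, a.2 - 1)} : Finset Site), ?_, ?_⟩
  · rintro D hD ⟨u, v⟩ h
    have h' := (mem_bd _ _ _).1 h
    have h2 := (adj_iff _ _).1 h'.2.2
    refine Finset.mem_product.2 ⟨Finset.mem_biUnion.2 ⟨u, hD h'.1, by simp⟩,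
      Finset.mem_biUnion.2 ⟨u, hD h'.1, ?_⟩⟩
    simp only [Finset.mem_insert, Finset.mem_singleton]
    tauto
  · intro η hη
    rw [dgH, tsum_eq_sum]
    rintro ⟨u, v⟩ hp
    by_cases huv : adjP u v
    · have hu : u ∉ W := by
        intro hu
        apply hp
        have h2 := (adj_iff _ _).1 huv
        refine Finset.mem_product.2 ⟨Finset.mem_biUnion.2 ⟨u, hu, by simp⟩,
          Finset.mem_biUnion.2 ⟨u, hu, ?_⟩⟩
        simp only [Finset.mem_insert, Finset.mem_singleton]
        tauto
      have hv : v ∉ W := by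
        intro hv
        apply hp
        have h2 := (adj_iff _ _).1 (adj_symm huv)
        refine Finset.mem_product.2 ⟨Finset.mem_biUnion.2 ⟨v, hv, ?_⟩,
          Finset.mem_biUnion.2 ⟨v, hv, by simp⟩⟩
        simp only [Finset.mem_insert, Finset.mem_singleton]
        tauto
      simp [hη u hu, hη v hv]
    · simp [huv]

/-- lower `η` by one on `D` -/
def sh (D : Finset Site) (η : Site → ℤ) : Site → ℤ := fun u => η u - if u ∈ D then 1 else 0

lemma sh_inj (D : Finset Site) : Function.Injective (sh D) := by
  intro a b h
  funext u
  have := congrFun h u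
  simpa [sh] using this

lemma energy (V D : Finset Site) (hDV : D ⊆ V) (η : Site → ℤ) (hη : ∀ x, x ∉ V → η x = 0) (k : ℤ)
    (hk : ∀ u ∈ D, ∀ v, v ∉ D → adjP u v → k + 1 ≤ η u ∧ η v ≤ k) :
    dgH (sh D η) + (bd D).card ≤ dgH η := by
  obtain ⟨N, hN1, hN2⟩ := dgH_eq V
  have hsh : ∀ x, x ∉ V → sh D η x = 0 := fun x hx => by
    have hxD : x ∉ D := fun h => hx (hDV h)
    simp [sh, hη x hx, hxD]
  rw [hN2 η hη, hN2 _ hsh]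
  have c1 : ∑ p ∈ N ×ˢ N, (if p ∈ bd D then (1 : ℝ) else 0) = (bd D).card := by
    rw [Finset.sum_ite_mem, Finset.inter_eq_right.2 (hN1 D hDV)]
    simp
  have c2 : ∑ p ∈ N ×ˢ N, (if p.swap ∈ bd D then (1 : ℝ) else 0) = (bd D).card := by
    rw [← c1]
    refine Finset.sum_equiv (Equiv.prodComm Site Site) ?_ ?_
    · intro p; simp [and_comm]
    · intro p _; rfl
  have key : ∑ p ∈ N ×ˢ N, ((if adjP p.1 p.2 then ((sh D η p.1 - sh D η p.2 : ℤ) : ℝ) ^ 2 else 0)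
      + (if p ∈ bd D then (1 : ℝ) else 0) + (if p.swap ∈ bd D then (1 : ℝ) else 0)) ≤
      ∑ p ∈ N ×ˢ N, if adjP p.1 p.2 then ((η p.1 - η p.2 : ℤ) : ℝ) ^ 2 else 0 := by
    apply Finset.sum_le_sum
    rintro ⟨u, v⟩ _
    simp only [Prod.swap_prod_mk, mem_bd]
    by_cases huv : adjP u v
    · have hvu := adj_symm huv
      simp only [huv, hvu, and_true, if_true]
      by_cases hu : u ∈ D <;> by_cases hv : v ∈ D
      · simp [sh, hu, hv]
      · have := hk u hu v hv huv
        simp only [sh, hu, hv, if_true, if_false, not_true, not_false_iff, and_true, and_false]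
        have h : (η u - 1 - (η v - 0)) ^ 2 + 1 ≤ (η u - η v) ^ 2 := by nlinarith
        have h' : (((η u - 1 - (η v - 0) : ℤ) : ℝ)) ^ 2 + 1 ≤ ((η u - η v : ℤ) : ℝ) ^ 2 := by
          exact_mod_cast h
        linarith
      · have := hk v hv u hu hvu
        simp only [sh, hu, hv, if_true, if_false, not_true, not_false_iff, and_true, and_false]
        have h : (η u - 0 - (η v - 1)) ^ 2 + 1 ≤ (η u - η v) ^ 2 := by nlinarith
        have h' : (((η u - 0 - (η v - 1) : ℤ) : ℝ)) ^ 2 + 1 ≤ ((η u - η v : ℤ) : ℝ) ^ 2 := by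
          exact_mod_cast h
        linarith
      · simp [sh, hu, hv]
    · have hvu : ¬ adjP v u := fun h => huv (adj_symm h)
      simp [huv, hvu]
  rw [Finset.sum_add_distrib, Finset.sum_add_distrib, c1, c2] at key
  linarith

/-! ### Peierls argument -/

open scoped ENNReal

/-- weight -/
def wt (β : ℝ) (η : Site → ℤ) : ℝ≥0∞ := ENNReal.ofReal (Real.exp (-β * dgH η))

/-- weight of an event -/
def EW (β : ℝ) (V : Finset Site) (A : (Site → ℤ) → Prop) : ℝ≥0∞ :=
  ∑' η : Site → ℤ, if (∀ x ∉ V, η x = 0) ∧ A η then wt β η else 0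

lemma EW_le_tsum {ι : Type} (β : ℝ) (V : Finset Site) (P : (Site → ℤ) → Prop)
    (Q : ι → (Site → ℤ) → Prop) (h : ∀ η, (∀ x ∉ V, η x = 0) → P η → ∃ i, Q i η) :
    EW β V P ≤ ∑' i, EW β V (Q i) := by
  unfold EW
  rw [ENNReal.tsum_comm]
  apply ENNReal.tsum_le_tsum
  intro η
  by_cases hc : (∀ x ∉ V, η x = 0) ∧ P η
  · obtain ⟨i, hi⟩ := h η hc.1 hc.2
    refine le_trans ?_ (ENNReal.le_tsum i)
    rw [if_pos hc, if_pos ⟨hc.1, hi⟩]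
  · rw [if_neg hc]; exact zero_le

lemma shift_bound (β : ℝ) (hβ : 0 ≤ β) (V D : Finset Site) (hDV : D ⊆ V) (z : Site) (k : ℤ)
    (P : (Site → ℤ) → Prop)
    (hP : ∀ η, P η → η z = k + 1 ∧ z ∈ D ∧
      ∀ u ∈ D, ∀ v, v ∉ D → adjP u v → k + 1 ≤ η u ∧ η v ≤ k) :
    EW β V P ≤ ENNReal.ofReal (Real.exp (-β)) ^ (bd D).card * EW β V (fun η => η z = k) := by
  unfold EW
  rw [← ENNReal.tsum_mul_left]
  refine le_trans ?_ (ENNReal.tsum_comp_le_tsum_of_injective (sh_inj D) _)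
  apply ENNReal.tsum_le_tsum
  intro η
  by_cases hc : (∀ x ∉ V, η x = 0) ∧ P η
  · obtain ⟨h1, h2, h3⟩ := hP η hc.2
    have hs : (∀ x ∉ V, sh D η x = 0) ∧ sh D η z = k := by
      refine ⟨fun x hx => ?_, by simp [sh, h1, h2]⟩
      have hxD : x ∉ D := fun h => hx (hDV h)
      simp [sh, hc.1 x hx, hxD]
    rw [if_pos hc, if_pos hs, wt, wt, ← ENNReal.ofReal_pow (Real.exp_pos _).le,
      ← ENNReal.ofReal_mul (by positivity), ← Real.exp_nat_mul, ← Real.exp_add]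
    apply ENNReal.ofReal_le_ofReal
    apply Real.exp_le_exp.2
    have := energy V D hDV η hc.1 k h3
    nlinarith
  · rw [if_neg hc]; exact zero_le

lemma peel (β : ℝ) (hβ : 0 ≤ β) (V : Finset Site) (z : Site) (k : ℤ) (hk : 0 ≤ k)
    (hS : ∀ x : Site, ∑' A : {A : Finset Site // x ∈ A ∧ IsCont A},
      ENNReal.ofReal (Real.exp (-β)) ^ (bd A.1).card ≤ 1) :
    ∀ n : ℕ, ∀ D : Finset Site, (D \ V).card < n →
      EW β V (fun η => η z = k + 1 ∧ Good (comp (fun u => k + 1 ≤ η u) z) D) ≤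
        ENNReal.ofReal (Real.exp (-β)) ^ (bd D).card * EW β V (fun η => η z = k) := by
  have hq : ENNReal.ofReal (Real.exp (-β)) ≤ 1 := by
    rw [← ENNReal.ofReal_one]
    apply ENNReal.ofReal_le_ofReal
    simpa using hβ
  intro n
  induction n with
  | zero => intro D h; omega
  | succ n ih =>
    intro D hD
    by_cases hDV : D ⊆ V
    · apply shift_bound β hβ V D hDV z k
      rintro η ⟨h1, h2⟩
      refine ⟨h1, h2.1 (comp_self _ _), ?_⟩
      intro u hu v hv huv
      have huC := h2.2 u hu v hv huv
      refine ⟨comp_sub (P := fun u => k + 1 ≤ η u) (by rw [h1]) huC, ?_⟩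
      by_contra hc
      exact hv (h2.1 (comp_step huC huv (by omega)))
    · obtain ⟨x, hxD, hxV⟩ := Finset.not_subset.1 hDV
      let C : Finset Site → Prop := fun K => (bd D).card + (bd K).card ≤ (bd (D \ K)).card
      refine le_trans (EW_le_tsum (ι := {A : Finset Site // x ∈ A ∧ IsCont A}) β V _
        (fun K η => C K.1 ∧ η z = k + 1 ∧ Good (comp (fun u => k + 1 ≤ η u) z) (D \ K.1)) ?_) ?_
      · rintro η hη ⟨h1, h2⟩
        have hxC : x ∉ comp (fun u => k + 1 ≤ η u) z := by
          intro hx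
          have := comp_sub (P := fun u => k + 1 ≤ η u) (by rw [h1]) hx
          rw [hη x hxV] at this
          omega
        obtain ⟨K, h3, h4, h5⟩ := exists_hole h2 hxD hxC
        exact ⟨⟨K, h3⟩, h5, h1, h4⟩
      · calc _ ≤ ∑' K : {A : Finset Site // x ∈ A ∧ IsCont A},
              ENNReal.ofReal (Real.exp (-β)) ^ (bd K.1).card *
              (ENNReal.ofReal (Real.exp (-β)) ^ (bd D).card * EW β V (fun η => η z = k)) := by
              apply ENNReal.tsum_le_tsum
              intro K
              by_cases hC : C K.1
              · simp only [hC, true_and]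
                refine le_trans (ih (D \ K.1) ?_) ?_
                · have : (D \ K.1) \ V ⊂ D \ V := by
                    rw [Finset.ssubset_iff_of_subset]
                    · exact ⟨x, by simp [hxD, hxV], by simp [K.2.1]⟩
                    · exact Finset.sdiff_subset_sdiff Finset.sdiff_subset le_rfl
                  have := Finset.card_lt_card this
                  omega
                · rw [← mul_assoc, ← pow_add]
                  gcongr ?_ * _
                  apply pow_le_pow_right_of_le_one' hq
                  simp only [C] at hC
                  omega
              · simp [hC, EW]
          _ ≤ 1 * (ENNReal.ofReal (Real.exp (-β)) ^ (bd D).card * EW β V (fun η => η z = k)) := by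
              rw [ENNReal.tsum_mul_right]
              gcongr
              exact hS x
          _ = _ := one_mul _

lemma level_step (β : ℝ) (hβ : 0 ≤ β) (V : Finset Site) (z : Site) (δ : ℝ≥0∞) (hδ : δ ≤ 1)
    (hS : ∀ x : Site, ∑' A : {A : Finset Site // x ∈ A ∧ IsCont A},
      ENNReal.ofReal (Real.exp (-β)) ^ (bd A.1).card ≤ δ) (k : ℤ) (hk : 0 ≤ k) :
    EW β V (fun η => η z = k + 1) ≤ δ * EW β V (fun η => η z = k) := by
  refine le_trans (EW_le_tsum (ι := {A : Finset Site // z ∈ A ∧ IsCont A}) β V _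
    (fun A η => η z = k + 1 ∧ Good (comp (fun u => k + 1 ≤ η u) z) A.1) ?_) ?_
  · intro η hη h1
    have hV : comp (fun u => k + 1 ≤ η u) z ⊆ ↑V := by
      intro u hu
      by_contra huV
      have := comp_sub (P := fun u => k + 1 ≤ η u) (by rw [h1]) hu
      rw [hη u huV] at this
      omega
    obtain ⟨D, h2, h3⟩ := exists_outer hV
    exact ⟨⟨D, h2⟩, h1, h3⟩
  · refine le_trans (ENNReal.tsum_le_tsum fun A =>
      peel β hβ V z k hk (fun x => (hS x).trans hδ) _ A.1 (Nat.lt_succ_self _)) ?_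
    rw [ENNReal.tsum_mul_right]
    gcongr
    exact hS z

lemma level_sum (β : ℝ) (hβ : 0 ≤ β) (V : Finset Site) (z : Site) (δ : ℝ≥0∞) (hδ : δ ≤ 2⁻¹)
    (hS : ∀ x : Site, ∑' A : {A : Finset Site // x ∈ A ∧ IsCont A},
      ENNReal.ofReal (Real.exp (-β)) ^ (bd A.1).card ≤ δ) (h : ℕ) :
    EW β V (fun η => (h : ℤ) < η z) ≤ 2 * δ * EW β V (fun η => η z = (h : ℤ)) := by
  have hδ1 : δ ≤ 1 := hδ.trans (by norm_num)
  have hstep : ∀ i : ℕ, EW β V (fun η => η z = (h : ℤ) + i) ≤ δ ^ i * EW β V (fun η => η z = (h : ℤ)) := by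
    intro i
    induction i with
    | zero => simp
    | succ i ih =>
      have := level_step β hβ V z δ hδ1 hS ((h : ℤ) + i) (by positivity)
      push_cast
      rw [← add_assoc, pow_succ', mul_assoc]
      exact this.trans (by gcongr)
  refine le_trans (EW_le_tsum β V _ (fun (i : ℕ) η => η z = (h : ℤ) + (i + 1 : ℕ)) ?_) ?_
  · intro η _ h1
    exact ⟨(η z - h - 1).toNat, by push_cast; omega⟩
  · refine le_trans (ENNReal.tsum_le_tsum fun i => hstep (i + 1)) ?_
    rw [ENNReal.tsum_mul_right]
    gcongr
    simp only [pow_succ]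
    rw [ENNReal.tsum_mul_right, ENNReal.tsum_geometric]
    gcongr
    have : (2 : ℝ≥0∞)⁻¹ ≤ 1 - δ := by
      calc (2 : ℝ≥0∞)⁻¹ = 1 - 2⁻¹ := by rw [ENNReal.one_sub_inv_two]
        _ ≤ 1 - δ := tsub_le_tsub_left hδ 1
    exact ENNReal.inv_le_iff_inv_le.1 this

lemma dgW_eq (β : ℝ) (V : Finset Site) (A : (Site → ℤ) → Prop)
    (hs : Summable fun η : Site → ℤ =>
      if (∀ x ∉ V, η x = 0) ∧ True then Real.exp (-β * dgH η) else 0) :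
    ENNReal.ofReal (dgW β V A) = EW β V A ∧ 0 ≤ dgW β V A := by
  have hnn : ∀ η : Site → ℤ,
      0 ≤ if (∀ x ∉ V, η x = 0) ∧ A η then Real.exp (-β * dgH η) else 0 := by
    intro η; split_ifs <;> positivity
  have hsA : Summable fun η : Site → ℤ =>
      if (∀ x ∉ V, η x = 0) ∧ A η then Real.exp (-β * dgH η) else 0 := by
    refine Summable.of_nonneg_of_le hnn (fun η => ?_) hs
    by_cases h1 : (∀ x ∉ V, η x = 0) <;> by_cases h2 : A η
    · rw [if_pos ⟨h1, h2⟩, if_pos ⟨h1, trivial⟩]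
    · rw [if_neg (fun h => h2 h.2), if_pos ⟨h1, trivial⟩]; positivity
    · rw [if_neg (fun h => h1 h.1), if_neg (fun h => h1 h.1)]
    · rw [if_neg (fun h => h1 h.1), if_neg (fun h => h1 h.1)]
  refine ⟨?_, tsum_nonneg hnn⟩
  rw [dgW, ENNReal.ofReal_tsum_of_nonneg hnn hsA, EW]
  congr 1
  ext1 η
  split_ifs <;> simp [wt]

/-- **Claim 2.3.** For large `β`, `π_V(η_z > h) ≤ ε · π_V(η_z = h)`. -/
theorem dg_peierls_level_ratio (ε : ℝ) (hε0 : 0 < ε) (hε1 : ε < 1) :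
    ∃ β₀ > (0 : ℝ), ∀ β ≥ β₀, ∀ V : Finset Site, FinConnected V → ∀ z ∈ V, ∀ h : ℕ,
      dgProb β V (fun η => (h : ℤ) < η z) ≤ ε * dgProb β V (fun η => η z = (h : ℤ)) := by
  obtain ⟨r, hr0, hr⟩ : ∃ r : ℝ, 0 < r ∧ r = min (1 / 162) (ε / 8) := ⟨_, by positivity, rfl⟩
  have hr1 : r ≤ 1 / 162 := hr ▸ min_le_left _ _
  have hr2 : r ≤ ε / 8 := hr ▸ min_le_right _ _
  refine ⟨-3 * Real.log r, ?_, ?_⟩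
  · have := Real.log_neg hr0 (by linarith)
    linarith
  intro β hβ V _ z _ h
  have hβ0 : 0 ≤ β := by
    have := Real.log_neg hr0 (by linarith)
    linarith
  by_cases hs : Summable fun η : Site → ℤ =>
      if (∀ x ∉ V, η x = 0) ∧ True then Real.exp (-β * dgH η) else 0
  swap
  · have h0 : dgW β V (fun _ => True) = 0 := by
      refine tsum_eq_zero_of_not_summable (fun hc => hs ?_)
      convert hc using 3
    simp [dgProb, h0]
  have hq : ENNReal.ofReal (Real.exp (-β)) ≤ ENNReal.ofReal r ^ 3 := by
    rw [← ENNReal.ofReal_pow hr0.le]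
    apply ENNReal.ofReal_le_ofReal
    rw [← Real.exp_log (pow_pos hr0 3), Real.log_pow]
    apply Real.exp_le_exp.2
    push_cast
    linarith
  have h81 : 81 * ENNReal.ofReal r ≤ 2⁻¹ := by
    have : (81 : ENNReal) = ENNReal.ofReal 81 := by simp
    rw [this, ← ENNReal.ofReal_mul (by norm_num)]
    have : (2⁻¹ : ENNReal) = ENNReal.ofReal 2⁻¹ := by
      rw [ENNReal.ofReal_inv_of_pos (by norm_num)]; simp
    rw [this]
    apply ENNReal.ofReal_le_ofReal
    linarith
  have hS : ∀ x : Site, ∑' A : {A : Finset Site // x ∈ A ∧ IsCont A},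
      ENNReal.ofReal (Real.exp (-β)) ^ (bd A.1).card ≤ ENNReal.ofReal (ε / 2) := by
    intro x
    refine le_trans (ENNReal.tsum_le_tsum fun A => ?_) ((contour_sum x _ h81).trans ?_)
    · gcongr
    · have : (4 : ENNReal) = ENNReal.ofReal 4 := by simp
      rw [this, ← ENNReal.ofReal_mul (by norm_num)]
      apply ENNReal.ofReal_le_ofReal
      linarith
  have hδ : ENNReal.ofReal (ε / 2) ≤ 2⁻¹ := by
    have : (2⁻¹ : ENNReal) = ENNReal.ofReal 2⁻¹ := by
      rw [ENNReal.ofReal_inv_of_pos (by norm_num)]; simp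
    rw [this]
    apply ENNReal.ofReal_le_ofReal
    linarith
  have main := level_sum β hβ0 V z _ hδ hS h
  obtain ⟨e1, _⟩ := dgW_eq β V (fun η => (h : ℤ) < η z) hs
  obtain ⟨e2, n2⟩ := dgW_eq β V (fun η => η z = (h : ℤ)) hs
  obtain ⟨_, n3⟩ := dgW_eq β V (fun _ => True) hs
  have h2 : (2 : ENNReal) = ENNReal.ofReal 2 := by simp
  rw [← e1, ← e2, h2, ← ENNReal.ofReal_mul (by norm_num), ← ENNReal.ofReal_mul (by positivity),
    ENNReal.ofReal_le_ofReal_iff (by positivity)] at main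
  rw [dgProb, dgProb, ← mul_div_assoc]
  gcongr
  linarith
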